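/- arXiv:0705.3457 — 5 statements merged into one kernel-verified Lean document; each statement's English description precedes it below -/
import Mathlib

section
/- Let G be a regular graph of order n and (finite) diameter D. If H is a proper subgraph of G, then μ(G) − μ(H) > 1/(nD). -/
open SimpleGraph Finset

/-- The adjacency matrix of a simple graph is Hermitian (it is a real symmetric matrix). -/
lemma adjMatrix_isHermitian {n : ℕ} (G : SimpleGraph (Fin n)) [DecidableRel G.Adj] :
    (G.adjMatrix ℝ).IsHermitian := by
  ext i j
  simp [Matrix.conjTranspose_apply, adj_comm]

/-- `specMax G` is `μ(G)`, the largest eigenvalue of the adjacency matrix of `G`. -/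
noncomputable def specMax {n : ℕ} (G : SimpleGraph (Fin n)) [DecidableRel G.Adj] : ℝ :=
  ⨆ i, (adjMatrix_isHermitian G).eigenvalues i

/-- `specMin G` is `μ_min(G)`, the smallest eigenvalue of the adjacency matrix of `G`. -/
noncomputable def specMin {n : ℕ} (G : SimpleGraph (Fin n)) [DecidableRel G.Adj] : ℝ :=
  ⨅ i, (adjMatrix_isHermitian G).eigenvalues i

/-- Adding one resistor of conductance one in series. -/
lemma add_sq_le_succ_mul {X c R : ℝ} {k : ℕ} (h : X ^ 2 ≤ k * R) (hR : 0 ≤ R) :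
    (X + c) ^ 2 ≤ (k + 1) * (R + c ^ 2) := by
  rcases Nat.eq_zero_or_pos k with rfl | hk
  · have : X = 0 := by simpa using h
    subst this
    simp
    exact hR
  · have hk' : (0 : ℝ) < k := by exact_mod_cast hk
    have h1 : 2 * X * c * k ≤ X ^ 2 + (k * c) ^ 2 := by nlinarith [sq_nonneg (X - k * c)]
    have h2 : 2 * X * c ≤ R + k * c ^ 2 := by
      have : (2 * X * c) * k ≤ (R + k * c ^ 2) * k := by nlinarith
      exact le_of_mul_le_mul_right this hk'
    nlinarith

namespace SimpleGraph

variable {V : Type*}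

/-- A vertex at positive distance from `s` has a neighbour one step closer to `s`. -/
lemma Connected.exists_adj_dist_eq {G : SimpleGraph V} (hG : G.Connected) {s a : V} {k : ℕ}
    (h : G.dist s a = k + 1) : ∃ b, G.Adj b a ∧ G.dist s b = k := by
  obtain ⟨p, hp⟩ := hG.exists_walk_length_eq_dist a s
  cases p with
  | nil => simp at h
  | @cons _ b _ hab q =>
    refine ⟨b, hab.symm, ?_⟩
    have h1 := dist_le q
    have h2 := hG.dist_triangle (u := s) (v := b) (w := a)
    rw [dist_eq_one_iff_adj.mpr hab.symm] at h2
    rw [dist_comm] at h1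
    rw [Walk.length_cons, dist_comm] at hp
    omega

variable [Fintype V] (G : SimpleGraph V) [DecidableRel G.Adj]

/-- The edges of the ball of radius `k` around `s` that join consecutive distance layers,
oriented away from `s`. -/
noncomputable def layerEdges (s : V) (k : ℕ) : Finset (V × V) :=
  {e | G.Adj e.1 e.2 ∧ G.dist s e.2 = G.dist s e.1 + 1 ∧ G.dist s e.2 ≤ k}

/-- The Dirichlet energy of `x` along `G.layerEdges s k`. -/
noncomputable def layerEnergy (s : V) (x : V → ℝ) (k : ℕ) : ℝ :=
  ∑ e ∈ G.layerEdges s k, (x e.1 - x e.2) ^ 2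

variable {G}

lemma layerEnergy_nonneg (s : V) (x : V → ℝ) (k : ℕ) : 0 ≤ G.layerEnergy s x k :=
  Finset.sum_nonneg fun _ _ ↦ sq_nonneg _

variable [DecidableEq V]

lemma sum_add_layerEnergy_le (s : V) (x : V → ℝ) (k : ℕ) (T : Finset (V × V))
    (hT : ∀ e ∈ T, G.Adj e.1 e.2 ∧ G.dist s e.1 = k ∧ G.dist s e.2 = k + 1) :
    ∑ e ∈ T, (x e.1 - x e.2) ^ 2 + G.layerEnergy s x k ≤ G.layerEnergy s x (k + 1) := by
  have hdisj : Disjoint T (G.layerEdges s k) := by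
    refine Finset.disjoint_left.mpr fun e he he' ↦ ?_
    have h1 := hT e he
    simp only [layerEdges, Finset.mem_filter] at he'
    omega
  rw [layerEnergy, ← Finset.sum_union hdisj]
  refine Finset.sum_le_sum_of_subset_of_nonneg (fun e he ↦ ?_) fun _ _ _ ↦ sq_nonneg _
  simp only [layerEdges, Finset.mem_union, Finset.mem_filter, Finset.mem_univ, true_and] at he ⊢
  rcases he with he | he
  · obtain ⟨h1, h2, h3⟩ := hT e he
    exact ⟨h1, by omega, by omega⟩
  · exact ⟨he.1, he.2.1, by omega⟩

lemma sq_add_sq_add_layerEnergy_le {s : V} {x : V → ℝ} {k : ℕ} {a b a' b' : V} (hab : a ≠ b)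
    (ha : G.dist s a = k + 1) (hb : G.dist s b = k + 1) (ha' : G.dist s a' = k)
    (hb' : G.dist s b' = k) (haa : G.Adj a' a) (hbb : G.Adj b' b) :
    (x a' - x a) ^ 2 + (x b' - x b) ^ 2 + G.layerEnergy s x k ≤ G.layerEnergy s x (k + 1) := by
  have h := sum_add_layerEnergy_le (G := G) s x k {(a', a), (b', b)} (by
    intro e he
    simp only [Finset.mem_insert, Finset.mem_singleton] at he
    rcases he with rfl | rfl
    · exact ⟨haa, ha', ha⟩
    · exact ⟨hbb, hb', hb⟩)
  rwa [Finset.sum_pair (by simp [hab])] at h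

/-- The potential drop from `s` to the average of two vertices at distance `k` is bounded in terms
of the energy of the layers up to `k`. -/
lemma Connected.sq_sub_le_mul_layerEnergy (hG : G.Connected) (s : V) (x : V → ℝ) (k : ℕ) :
    ∀ a b : V, G.dist s a = k → G.dist s b = k →
      (x s - (x a + x b) / 2) ^ 2 ≤ k * G.layerEnergy s x k := by
  induction k with
  | zero =>
    intro a b ha hb
    rw [hG.dist_eq_zero_iff] at ha hb
    subst ha hb
    simp
  | succ k ih =>
    intro a b ha hb
    obtain ⟨a', haa, ha'⟩ := hG.exists_adj_dist_eq ha
    have key : ∃ b', G.dist s b' = k ∧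
        (((x a' + x b') - (x a + x b)) / 2) ^ 2 + G.layerEnergy s x k
          ≤ G.layerEnergy s x (k + 1) := by
      by_cases hab : a = b
      · subst hab
        refine ⟨a', ha', ?_⟩
        have h := sum_add_layerEnergy_le (G := G) s x k {(a', a)} (by
          intro e he
          rw [Finset.mem_singleton] at he
          subst he
          exact ⟨haa, ha', ha⟩)
        rw [Finset.sum_singleton] at h
        linarith [show (((x a' + x a') - (x a + x a)) / 2) ^ 2 = (x a' - x a) ^ 2 by ring]
      · obtain ⟨b', hbb, hb'⟩ := hG.exists_adj_dist_eq hb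
        refine ⟨b', hb', ?_⟩
        have h := sq_add_sq_add_layerEnergy_le (x := x) hab ha hb ha' hb' haa hbb
        nlinarith [sq_nonneg (x a' - x a + (x b' - x b)), sq_nonneg (x a' - x a - (x b' - x b))]
    obtain ⟨b', hb', hle⟩ := key
    have h := add_sq_le_succ_mul (c := ((x a' + x b') - (x a + x b)) / 2) (ih a' b' ha' hb')
      (layerEnergy_nonneg s x k)
    calc (x s - (x a + x b) / 2) ^ 2
        = (x s - (x a' + x b') / 2 + ((x a' + x b') - (x a + x b)) / 2) ^ 2 := by ring
      _ ≤ (k + 1) * (G.layerEnergy s x k + (((x a' + x b') - (x a + x b)) / 2) ^ 2) := h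
      _ ≤ (k + 1) * G.layerEnergy s x (k + 1) := by gcongr; linarith
      _ = _ := by push_cast; ring

/-- Grounding two distinct vertices `u`, `v`, with `u` at least as close to `s` as `v`, the
potential at `s` is controlled by the diameter and the total energy. -/
lemma Connected.sq_le_mul_layerEnergy_add (hG : G.Connected) {s u v : V} (huv : u ≠ v)
    (x : V → ℝ) {D : ℕ} (hD : 0 < D) (hdist : ∀ a, G.dist s a ≤ D)
    (hle : G.dist s u ≤ G.dist s v) :
    x s ^ 2 ≤ D * (G.layerEnergy s x (G.dist s u) + x u ^ 2 + x v ^ 2) := by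
  rcases (hdist u).lt_or_eq with hlt | heq
  · have h := add_sq_le_succ_mul (c := x u) (hG.sq_sub_le_mul_layerEnergy s x _ u u rfl rfl)
      (layerEnergy_nonneg s x _)
    have hR := layerEnergy_nonneg (G := G) s x (G.dist s u)
    have hk : ((G.dist s u : ℕ) : ℝ) + 1 ≤ D := by exact_mod_cast hlt
    calc x s ^ 2 = (x s - (x u + x u) / 2 + x u) ^ 2 := by ring
      _ ≤ _ := h
      _ ≤ D * (G.layerEnergy s x (G.dist s u) + x u ^ 2) := by gcongr
      _ ≤ _ := mul_le_mul_of_nonneg_left (by linarith [sq_nonneg (x v)]) (by positivity)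
  · have heqv : G.dist s v = D := le_antisymm (hdist v) (heq ▸ hle)
    rw [heq]
    obtain ⟨k, rfl⟩ : ∃ k, D = k + 1 := ⟨D - 1, by omega⟩
    obtain ⟨a, hau, ha⟩ := hG.exists_adj_dist_eq heq
    obtain ⟨b, hbv, hb⟩ := hG.exists_adj_dist_eq heqv
    have h1 := sq_add_sq_add_layerEnergy_le (x := x) huv heq heqv ha hb hau hbv
    have h := add_sq_le_succ_mul (c := (x a + x b) / 2)
      (hG.sq_sub_le_mul_layerEnergy s x k a b ha hb) (layerEnergy_nonneg s x _)
    have h2 : ((x a + x b) / 2) ^ 2 ≤ (x a - x u) ^ 2 + (x b - x v) ^ 2 + x u ^ 2 + x v ^ 2 := by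
      nlinarith [sq_nonneg (x a - 2 * x u), sq_nonneg (x b - 2 * x v), sq_nonneg (x a - x b)]
    calc x s ^ 2 = (x s - (x a + x b) / 2 + (x a + x b) / 2) ^ 2 := by ring
      _ ≤ _ := h
      _ ≤ (k + 1) * (G.layerEnergy s x (k + 1) + x u ^ 2 + x v ^ 2) :=
        mul_le_mul_of_nonneg_left (by linarith) (by positivity)
      _ = _ := by push_cast; ring

lemma layerEnergy_eq_sum_ite (s : V) (x : V → ℝ) (k : ℕ) :
    G.layerEnergy s x k = ∑ i, ∑ j, if (i, j) ∈ G.layerEdges s k then (x i - x j) ^ 2 else 0 := by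
  rw [← Fintype.sum_prod_type' (f := fun i j ↦
    if (i, j) ∈ G.layerEdges s k then (x i - x j) ^ 2 else 0), layerEnergy,
    ← Finset.sum_filter]
  simp

/-- For a nonnegative vector and a spanning subgraph `H` missing the edge `uv`, the form
`d‖x‖² - ⟨x, A_H x⟩` dominates the layer energy together with the grounding terms at `u`, `v`. -/
lemma IsRegularOfDegree.layerEnergy_add_le {d : ℕ} (hreg : G.IsRegularOfDegree d)
    {H : SimpleGraph V} [DecidableRel H.Adj] (hsub : H ≤ G) {s u v : V} (hG : G.Adj u v)
    (hH : ¬ H.Adj u v) (hle : G.dist s u ≤ G.dist s v) {x : V → ℝ} (hx : ∀ i, 0 ≤ x i) :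
    G.layerEnergy s x (G.dist s u) + x u ^ 2 + x v ^ 2 ≤
      d * ∑ i, x i ^ 2 - ∑ i, ∑ j, if H.Adj i j then x i * x j else 0 := by
  set E := G.layerEdges s (G.dist s u) with hE
  have hsq : ∑ i, ∑ j, (if G.Adj i j then x i ^ 2 else 0) = d * ∑ i, x i ^ 2 := by
    rw [Finset.mul_sum]
    refine Finset.sum_congr rfl fun i _ ↦ ?_
    rw [← Finset.sum_filter, Finset.sum_const, nsmul_eq_mul, ← G.neighborFinset_eq_filter,
      G.card_neighborFinset_eq_degree, hreg i]
  have hsq' : ∑ i, ∑ j, (if G.Adj i j then x j ^ 2 else 0) = d * ∑ i, x i ^ 2 := by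
    rw [Finset.sum_comm, ← hsq]
    simp_rw [G.adj_comm]
  have hswap : ∑ i, ∑ j, (if (j, i) ∈ E then (x i - x j) ^ 2 else 0) =
      G.layerEnergy s x (G.dist s u) := by
    rw [Finset.sum_comm, layerEnergy_eq_sum_ite]
    refine Finset.sum_congr rfl fun i _ ↦ Finset.sum_congr rfl fun j _ ↦ ?_
    rw [← neg_sub, neg_sq]
  have hind (a b : V) (c : ℝ) : ∑ i, ∑ j, (if i = a ∧ j = b then c else 0) = c := by
    simp [ite_and]
  have hpt (i j : V) :
      ((if (i, j) ∈ E then (x i - x j) ^ 2 else 0) + (if (j, i) ∈ E then (x i - x j) ^ 2 else 0)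
        + (if i = u ∧ j = v then x u ^ 2 + x v ^ 2 else 0)
        + (if i = v ∧ j = u then x u ^ 2 + x v ^ 2 else 0)) / 2 ≤
      ((if G.Adj i j then x i ^ 2 else 0) + (if G.Adj i j then x j ^ 2 else 0)) / 2
        - (if H.Adj i j then x i * x j else 0) := by
    have hxx := mul_nonneg (hx i) (hx j)
    have hne := hG.ne
    by_cases h1 : i = u ∧ j = v
    · obtain ⟨rfl, rfl⟩ := h1
      have e1 : (i, j) ∉ E := by
        simp only [hE, layerEdges, Finset.mem_filter, not_and]; intros; omega
      have e2 : (j, i) ∉ E := by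
        simp only [hE, layerEdges, Finset.mem_filter, not_and]; intros; omega
      simp [e1, e2, hG, hH, hne]
    by_cases h2 : i = v ∧ j = u
    · obtain ⟨rfl, rfl⟩ := h2
      have e1 : (i, j) ∉ E := by
        simp only [hE, layerEdges, Finset.mem_filter, not_and]; intros; omega
      have e2 : (j, i) ∉ E := by
        simp only [hE, layerEdges, Finset.mem_filter, not_and]; intros; omega
      simp [e1, e2, hG.symm, H.adj_comm i j, hH, hne.symm, add_comm]
    rw [if_neg h1, if_neg h2]
    by_cases hadj : G.Adj i j
    · have hEE : (if (i, j) ∈ E then (x i - x j) ^ 2 else 0)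
          + (if (j, i) ∈ E then (x i - x j) ^ 2 else 0) ≤ (x i - x j) ^ 2 := by
        by_cases e1 : (i, j) ∈ E
        · have e2 : (j, i) ∉ E := by
            simp only [hE, layerEdges, Finset.mem_filter, not_and] at e1 ⊢; intros; omega
          simp [e1, e2]
        · split_ifs <;> simp [sq_nonneg]
      have hHle : (if H.Adj i j then x i * x j else 0) ≤ x i * x j := by
        split_ifs <;> simp [hxx]
      rw [if_pos hadj, if_pos hadj]
      nlinarith
    · have e1 : (i, j) ∉ E := by simp [hE, layerEdges, hadj]
      have e2 : (j, i) ∉ E := by simp [hE, layerEdges, G.adj_comm j i, hadj]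
      have hH' : ¬ H.Adj i j := fun h ↦ hadj (hsub h)
      simp [e1, e2, hadj, hH']
  have hsum := Finset.sum_le_sum fun i (_ : i ∈ Finset.univ) ↦
    Finset.sum_le_sum fun j (_ : j ∈ Finset.univ) ↦ hpt i j
  simp only [← Finset.sum_div, Finset.sum_add_distrib, Finset.sum_sub_distrib] at hsum
  rw [hsq, hsq', hswap, hind, hind, ← layerEnergy_eq_sum_ite] at hsum
  linarith

end SimpleGraph

lemma degree_le_specMax {n d : ℕ} [NeZero n] (G : SimpleGraph (Fin n)) [DecidableRel G.Adj]
    (hreg : G.IsRegularOfDegree d) : (d : ℝ) ≤ specMax G := by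
  have hmem : (d : ℝ) ∈ spectrum ℝ (G.adjMatrix ℝ) := by
    rw [← Matrix.spectrum_toLin']
    refine Module.End.HasEigenvalue.mem_spectrum
      (Module.End.hasEigenvalue_of_hasEigenvector (x := Function.const _ 1)
        (Module.End.hasEigenvector_iff.mpr ⟨?_, ?_⟩))
    · rw [Module.End.mem_eigenspace_iff]
      ext i
      simp [Matrix.toLin'_apply, hreg.degree_eq i]
    · exact fun h ↦ one_ne_zero (congrFun h (0 : Fin n))
  rw [(adjMatrix_isHermitian G).spectrum_real_eq_range_eigenvalues] at hmem
  obtain ⟨i, hi⟩ := hmem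
  rw [← hi]
  exact le_ciSup (Set.finite_range _).bddAbove i

/-- The largest eigenvalue is bounded by the quadratic form at some nonnegative unit vector. -/
lemma exists_nonneg_unit_specMax_le {n : ℕ} [NeZero n] (H : SimpleGraph (Fin n))
    [DecidableRel H.Adj] : ∃ x : Fin n → ℝ, (∀ i, 0 ≤ x i) ∧ ∑ i, x i ^ 2 = 1 ∧
      specMax H ≤ ∑ i, ∑ j, if H.Adj i j then x i * x j else 0 := by
  obtain ⟨k, hk⟩ := exists_eq_ciSup_of_finite (f := (adjMatrix_isHermitian H).eigenvalues)
  set y := (adjMatrix_isHermitian H).eigenvectorBasis k with hy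
  refine ⟨fun i ↦ |y i|, fun i ↦ abs_nonneg _, ?_, ?_⟩
  · have h := (adjMatrix_isHermitian H).eigenvectorBasis.norm_eq_one k
    rw [EuclideanSpace.norm_eq, Real.sqrt_eq_one] at h
    simpa using h
  · rw [specMax, ← hk, Matrix.IsHermitian.eigenvalues_eq]
    simp only [dotProduct, Matrix.mulVec, Finset.mul_sum, RCLike.re_to_real, Pi.star_apply,
      star_trivial, adjMatrix_apply]
    refine Finset.sum_le_sum fun i _ ↦ Finset.sum_le_sum fun j _ ↦ ?_
    split_ifs
    · rw [one_mul, ← abs_mul]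
      exact le_abs_self _
    · simp

/-- Let `G` be a regular graph of order `n` and (finite) diameter `D`. If `H` is a proper
subgraph of `G`, then `μ(G) − μ(H) > 1/(nD)`. -/
theorem spectral_gap_of_proper_subgraph {n D d : ℕ}
    (G H : SimpleGraph (Fin n)) [DecidableRel G.Adj] [DecidableRel H.Adj]
    (hreg : G.IsRegularOfDegree d) (hconn : G.Connected) (hD : G.diam = D)
    (hsub : H ≤ G) (hne : H ≠ G) :
    specMax G - specMax H > 1 / (n * D) := by
  obtain ⟨u₀, v₀, hG₀, hH₀⟩ : ∃ u v, G.Adj u v ∧ ¬ H.Adj u v := by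
    by_contra! h
    exact hne (le_antisymm hsub fun u v huv ↦ h u v huv)
  have : NeZero n := ⟨fun h ↦ by subst h; exact u₀.elim0⟩
  have hn : (0 : ℝ) < n := by exact_mod_cast Nat.pos_of_neZero n
  have hdist (a b : Fin n) : G.dist a b ≤ D :=
    hD ▸ dist_le_diam (connected_iff_ediam_ne_top.mp hconn)
  have hDpos : 0 < D := (hconn.pos_dist_of_ne hG₀.ne).trans_le (hdist u₀ v₀)
  have hD' : (1 : ℝ) ≤ D := by exact_mod_cast hDpos
  obtain ⟨x, hx, hnorm, hHx⟩ := exists_nonneg_unit_specMax_le H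
  obtain ⟨s, hs⟩ := Finite.exists_max x
  obtain ⟨u, v, hG, hH, hle⟩ :
      ∃ u v, G.Adj u v ∧ ¬ H.Adj u v ∧ G.dist s u ≤ G.dist s v := by
    rcases le_total (G.dist s u₀) (G.dist s v₀) with h | h
    · exact ⟨u₀, v₀, hG₀, hH₀, h⟩
    · exact ⟨v₀, u₀, hG₀.symm, fun h' ↦ hH₀ h'.symm, h⟩
  have hform := hreg.layerEnergy_add_le hsub hG hH hle hx
  have hgap : G.layerEnergy s x (G.dist s u) + x u ^ 2 + x v ^ 2 ≤ specMax G - specMax H := by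
    rw [hnorm, mul_one] at hform
    linarith [degree_le_specMax G hreg]
  have hpot := hconn.sq_le_mul_layerEnergy_add hG.ne x hDpos (hdist s) hle
  have hsq (i : Fin n) : x i ^ 2 ≤ x s ^ 2 := pow_le_pow_left₀ (hx i) (hs i) 2
  have hR := layerEnergy_nonneg (G := G) s x (G.dist s u)
  rw [gt_iff_lt, div_lt_iff₀ (by positivity)]
  suffices h : 1 < n * (D * (G.layerEnergy s x (G.dist s u) + x u ^ 2 + x v ^ 2)) by
    calc (1 : ℝ) < _ := h
      _ = (G.layerEnergy s x (G.dist s u) + x u ^ 2 + x v ^ 2) * (n * D) := by ring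
      _ ≤ _ := by gcongr
  by_cases hconst : ∀ i, x i ^ 2 = x s ^ 2
  · have h1 : (n : ℝ) * x s ^ 2 = 1 := by simpa [hconst] using hnorm
    rw [hconst u, hconst v]
    have h2 : 0 < x s ^ 2 := by
      by_contra! h
      nlinarith
    calc (1 : ℝ) < n * (1 * (0 + x s ^ 2 + x s ^ 2)) := by nlinarith
      _ ≤ _ := by gcongr
  · push Not at hconst
    obtain ⟨i, hi⟩ := hconst
    calc (1 : ℝ) = ∑ i, x i ^ 2 := hnorm.symm
      _ < ∑ _i : Fin n, x s ^ 2 :=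
        Finset.sum_lt_sum (fun i _ ↦ hsq i) ⟨i, Finset.mem_univ i, (hsq i).lt_of_ne hi⟩
      _ = n * x s ^ 2 := by simp
      _ ≤ _ := by gcongr
end

section
/- If G is a connected regular nonbipartite graph of order n and diameter D, then μ(G) + μ_min(G) > 1/(nD). -/
open SimpleGraph Finset

namespace SimpleGraph

section Layers

variable {V : Type*} {G : SimpleGraph V}

lemma Connected.exists_adj_dist_eq_of_dist_eq_succ (hconn : G.Connected) {u v : V} {k : ℕ}
    (h : G.dist u v = k + 1) : ∃ w, G.Adj w v ∧ G.dist u w = k := by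
  obtain ⟨p, hp⟩ := hconn.exists_walk_length_eq_dist v u
  rw [dist_comm, h] at hp
  cases p with
  | nil => simp at hp
  | @cons _ w _ hadj q =>
    refine ⟨w, hadj.symm, ?_⟩
    have h₁ := dist_le q
    have h₂ := hconn.dist_triangle (u := u) (v := w) (w := v)
    have h₃ := dist_eq_one_iff_adj.mpr hadj.symm
    rw [Walk.length_cons] at hp
    rw [dist_comm] at h₁
    omega

lemma exists_adj_dist_eq_of_not_colorable_two (hnb : ¬ G.Colorable 2) (u : V) :
    ∃ v w, G.Adj v w ∧ G.dist u v = G.dist u w := by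
  by_contra! h
  refine hnb ⟨Coloring.mk (fun v ↦ Fin.ofNat 2 (G.dist u v)) fun {v w} hvw heq ↦ ?_⟩
  have hne := h v w hvw
  have hmod : G.dist u v % 2 = G.dist u w % 2 := congrArg Fin.val heq
  have := hvw.diff_dist_adj (u := u)
  omega

variable (G) in
/-- The vector `x` with signs alternating with the distance from `u`. -/
noncomputable def alternating (u : V) (x : V → ℝ) (v : V) : ℝ := (-1) ^ G.dist u v * x v

lemma add_sq_eq_alternating_sub_sq {u v w : V} (x : V → ℝ) (h : G.dist u w = G.dist u v + 1) :
    (x v + x w) ^ 2 = (G.alternating u x v - G.alternating u x w) ^ 2 := by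
  have hs : ((-1 : ℝ) ^ G.dist u v) ^ 2 = 1 := by rw [← pow_mul', pow_mul]; norm_num
  rw [alternating, alternating, h, pow_succ]
  linear_combination (-(x v + x w) ^ 2) * hs

lemma add_sq_eq_alternating_add_sq {u v w : V} (x : V → ℝ) (h : G.dist u v = G.dist u w) :
    (x v + x w) ^ 2 = (G.alternating u x v + G.alternating u x w) ^ 2 := by
  have hs : ((-1 : ℝ) ^ G.dist u w) ^ 2 = 1 := by rw [← pow_mul', pow_mul]; norm_num
  rw [alternating, alternating, h]
  linear_combination (-(x v + x w) ^ 2) * hs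

variable [Fintype V]

variable (G) in
/-- The ordered pairs of adjacent vertices that lead one step away from `u` and end within
distance `i` of `u`. -/
noncomputable def outwardPairs (u : V) (i : ℕ) : Finset (V × V) := by
  classical
  exact {p | G.Adj p.1 p.2 ∧ G.dist u p.2 = G.dist u p.1 + 1 ∧ G.dist u p.2 ≤ i}

lemma mem_outwardPairs {u : V} {i : ℕ} {p : V × V} : p ∈ G.outwardPairs u i ↔
    G.Adj p.1 p.2 ∧ G.dist u p.2 = G.dist u p.1 + 1 ∧ G.dist u p.2 ≤ i := by
  simp [outwardPairs]

lemma sum_outwardPairs_add_le (u : V) (i : ℕ) (x : V → ℝ) (T : Finset (V × V))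
    (hT : ∀ p ∈ T, G.Adj p.1 p.2 ∧ G.dist u p.1 = i ∧ G.dist u p.2 = i + 1) :
    ∑ p ∈ G.outwardPairs u i, (x p.1 + x p.2) ^ 2 +
        ∑ p ∈ T, (G.alternating u x p.1 - G.alternating u x p.2) ^ 2 ≤
      ∑ p ∈ G.outwardPairs u (i + 1), (x p.1 + x p.2) ^ 2 := by
  classical
  have hsum : ∑ p ∈ T, (G.alternating u x p.1 - G.alternating u x p.2) ^ 2 =
      ∑ p ∈ T, (x p.1 + x p.2) ^ 2 := by
    refine sum_congr rfl fun p hp ↦ (add_sq_eq_alternating_sub_sq x ?_).symm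
    have := hT p hp
    omega
  rw [hsum, ← sum_union]
  · refine sum_le_sum_of_subset_of_nonneg (fun p hp ↦ ?_) fun _ _ _ ↦ sq_nonneg _
    rw [mem_outwardPairs]
    rcases mem_union.mp hp with hp | hp
    · obtain ⟨h₁, h₂, h₃⟩ := mem_outwardPairs.mp hp
      exact ⟨h₁, h₂, by omega⟩
    · obtain ⟨h₁, h₂, h₃⟩ := hT p hp
      exact ⟨h₁, by omega, by omega⟩
  · refine Finset.disjoint_left.mpr fun p hp hp' ↦ ?_
    have h₁ := (mem_outwardPairs.mp hp).2.2
    have h₂ := (hT p hp').2.2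
    omega

/-- Lower bounds, linear in `x`, for the energy of `x` on the edges between consecutive distance
layers around `u`; two distinct endpoints in the last layer improve the bound. -/
lemma Connected.le_sum_outwardPairs (hconn : G.Connected) (u : V) (x : V → ℝ) (t : ℝ) (i : ℕ) :
    ∀ v w, G.dist u v = i → G.dist u w = i →
      t * (2 * x u - G.alternating u x v - G.alternating u x w) - i * t ^ 2 ≤
          ∑ p ∈ G.outwardPairs u i, (x p.1 + x p.2) ^ 2 ∧
        (v ≠ w → t * (2 * x u - G.alternating u x v - G.alternating u x w) - (i - 1 / 2) * t ^ 2 ≤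
          ∑ p ∈ G.outwardPairs u i, (x p.1 + x p.2) ^ 2) := by
  classical
  induction i with
  | zero =>
    intro v w hv hw
    obtain rfl := hconn.dist_eq_zero_iff.mp hv
    obtain rfl := hconn.dist_eq_zero_iff.mp hw
    refine ⟨?_, fun h ↦ absurd rfl h⟩
    refine le_of_eq_of_le ?_ (sum_nonneg fun _ _ ↦ sq_nonneg _)
    simp [alternating]
    ring_nf
    simp
  | succ i ih =>
    intro v w hv hw
    obtain ⟨v', hvv, hv'⟩ := hconn.exists_adj_dist_eq_of_dist_eq_succ hv
    obtain ⟨w', hww, hw'⟩ := hconn.exists_adj_dist_eq_of_dist_eq_succ hw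
    by_cases hvw : v = w
    · subst hvw
      refine ⟨?_, fun h ↦ absurd rfl h⟩
      have h₁ := (ih v' v' hv' hv').1
      have h₂ := sum_outwardPairs_add_le (G := G) u i x {(v', v)} (by simp [*])
      rw [sum_singleton] at h₂
      push_cast
      linarith [sq_nonneg (G.alternating u x v' - G.alternating u x v - t)]
    · have h₁ := (ih v' w' hv' hw').1
      have h₂ := sum_outwardPairs_add_le (G := G) u i x {(v', v), (w', w)} (by simp [*])
      rw [sum_pair (by simp [hvw])] at h₂
      have hmain : t * (2 * x u - G.alternating u x v - G.alternating u x w) -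
          ((i : ℝ) + 1 / 2) * t ^ 2 ≤ ∑ p ∈ G.outwardPairs u (i + 1), (x p.1 + x p.2) ^ 2 := by
        linarith [sq_nonneg (G.alternating u x v' - G.alternating u x v - t / 2),
          sq_nonneg (G.alternating u x w' - G.alternating u x w - t / 2)]
      push_cast
      exact ⟨by linarith [sq_nonneg t], fun _ ↦ by linarith⟩

end Layers

section Energy

variable {V : Type*} [Fintype V] {G : SimpleGraph V} [DecidableRel G.Adj]

lemma two_mul_sum_outwardPairs_add_le (u : V) (x : V → ℝ) (i : ℕ) {v w : V} (hvw : G.Adj v w)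
    (hdist : G.dist u v = G.dist u w) :
    2 * (∑ p ∈ G.outwardPairs u i, (x p.1 + x p.2) ^ 2 + (x v + x w) ^ 2) ≤
      ∑ p : V × V with G.Adj p.1 p.2, (x p.1 + x p.2) ^ 2 := by
  classical
  set U := G.outwardPairs u i
  have hswap : ∑ p ∈ U.map (Equiv.prodComm V V).toEmbedding, (x p.1 + x p.2) ^ 2 =
      ∑ p ∈ U, (x p.1 + x p.2) ^ 2 := by
    rw [sum_map]
    exact sum_congr rfl fun p _ ↦ by simp [add_comm]
  have hpair : ∑ p ∈ ({(v, w), (w, v)} : Finset (V × V)), (x p.1 + x p.2) ^ 2 =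
      2 * (x v + x w) ^ 2 := by
    rw [sum_pair (by simp [hvw.ne])]
    ring
  have hd₁ : Disjoint U (U.map (Equiv.prodComm V V).toEmbedding) := by
    refine Finset.disjoint_left.mpr fun p hp hp' ↦ ?_
    obtain ⟨q, hq, rfl⟩ := mem_map.mp hp'
    have h₁ := (mem_outwardPairs.mp hp).2.1
    have h₂ := (mem_outwardPairs.mp hq).2.1
    simp at h₁
    omega
  have hd₂ : Disjoint (U ∪ U.map (Equiv.prodComm V V).toEmbedding) {(v, w), (w, v)} := by
    refine Finset.disjoint_left.mpr fun p hp hp' ↦ ?_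
    have heq : G.dist u p.1 = G.dist u p.2 := by
      rcases mem_insert.mp hp' with rfl | hp'
      · exact hdist
      · rw [mem_singleton.mp hp']
        exact hdist.symm
    rcases mem_union.mp hp with hp | hp
    · have := (mem_outwardPairs.mp hp).2.1
      omega
    · obtain ⟨q, hq, rfl⟩ := mem_map.mp hp
      have := (mem_outwardPairs.mp hq).2.1
      simp at heq
      omega
  calc 2 * (∑ p ∈ U, (x p.1 + x p.2) ^ 2 + (x v + x w) ^ 2)
      = ∑ p ∈ (U ∪ U.map (Equiv.prodComm V V).toEmbedding) ∪ {(v, w), (w, v)},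
          (x p.1 + x p.2) ^ 2 := by
        rw [sum_union hd₂, sum_union hd₁, hswap, hpair]
        ring
    _ ≤ _ := by
        refine sum_le_sum_of_subset_of_nonneg (fun p hp ↦ ?_) fun _ _ _ ↦ sq_nonneg _
        rw [mem_filter_univ]
        rcases mem_union.mp hp with hp | hp
        · rcases mem_union.mp hp with hp | hp
          · exact (mem_outwardPairs.mp hp).1
          · obtain ⟨q, hq, rfl⟩ := mem_map.mp hp
            exact (mem_outwardPairs.mp hq).1.symm
        · rcases mem_insert.mp hp with rfl | hp
          · exact hvw
          · rw [mem_singleton.mp hp]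
            exact hvw.symm

lemma IsRegularOfDegree.sum_add_sq_eq {d : ℕ} (hreg : G.IsRegularOfDegree d) {x : V → ℝ} {c : ℝ}
    (hx : (G.adjMatrix ℝ).mulVec x = c • x) :
    ∑ p : V × V with G.Adj p.1 p.2, (x p.1 + x p.2) ^ 2 = 2 * (d + c) * ∑ v, x v ^ 2 := by
  have hsum (f : V × V → ℝ) : ∑ p : V × V with G.Adj p.1 p.2, f p =
      ∑ a, ∑ b ∈ G.neighborFinset a, f (a, b) := by
    rw [sum_filter, Fintype.sum_prod_type]
    simp [neighborFinset_eq_filter, sum_filter]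
  have hnbr (a : V) : ∑ b ∈ G.neighborFinset a, x b = c * x a := by
    rw [← adjMatrix_mulVec_apply, hx, Pi.smul_apply, smul_eq_mul]
  have hleft : ∑ p : V × V with G.Adj p.1 p.2, x p.1 ^ 2 = d * ∑ v, x v ^ 2 := by
    rw [hsum, mul_sum]
    exact sum_congr rfl fun a _ ↦ by
      dsimp only
      rw [sum_const, card_neighborFinset_eq_degree, hreg.degree_eq, nsmul_eq_mul]
  have hright : ∑ p : V × V with G.Adj p.1 p.2, x p.2 ^ 2 =
      ∑ p : V × V with G.Adj p.1 p.2, x p.1 ^ 2 :=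
    sum_equiv (Equiv.prodComm V V) (fun p ↦ by simp [adj_comm]) fun p _ ↦ by simp
  have hmid : ∑ p : V × V with G.Adj p.1 p.2, x p.1 * x p.2 = c * ∑ v, x v ^ 2 := by
    rw [hsum, mul_sum]
    exact sum_congr rfl fun a _ ↦ by
      dsimp only
      rw [← mul_sum, hnbr]
      ring
  have hexp (p : V × V) : (x p.1 + x p.2) ^ 2 = x p.1 ^ 2 + x p.2 ^ 2 + 2 * (x p.1 * x p.2) := by
    ring
  simp_rw [hexp]
  rw [sum_add_distrib, sum_add_distrib, ← mul_sum, hright, hleft, hmid]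
  ring

/-- In a connected nonbipartite regular graph of degree `d`, an eigenvalue `c` exceeds `-d` by an
amount controlled by the diameter and the size of any entry of an eigenvector. -/
lemma Connected.sq_div_diam_lt_of_mulVec_eq_smul {d : ℕ} (hconn : G.Connected)
    (hreg : G.IsRegularOfDegree d) (hnb : ¬ G.Colorable 2) {x : V → ℝ} {c : ℝ}
    (hx : (G.adjMatrix ℝ).mulVec x = c • x) {u : V} (hu : x u ≠ 0) :
    x u ^ 2 / G.diam < (d + c) * ∑ v, x v ^ 2 := by
  obtain ⟨v, w, hvw, hdist⟩ := exists_adj_dist_eq_of_not_colorable_two hnb u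
  have := hconn.nonempty
  have : Nontrivial V := ⟨v, w, hvw.ne⟩
  have hD : (0 : ℝ) < G.diam :=
    Nat.cast_pos.mpr (Nat.pos_of_ne_zero (connected_iff_diam_ne_zero.mp hconn))
  have hle : (G.dist u v : ℝ) ≤ G.diam :=
    Nat.cast_le.mpr (dist_le_diam (connected_iff_ediam_ne_top.mp hconn))
  have h₁ := two_mul_sum_outwardPairs_add_le u x (G.dist u v) hvw hdist
  rw [hreg.sum_add_sq_eq hx, add_sq_eq_alternating_add_sq x hdist] at h₁
  set t := x u / G.diam with ht
  have h₂ := (hconn.le_sum_outwardPairs u x t _ v w rfl hdist.symm).2 hvw.ne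
  have h₃ := sq_nonneg (G.alternating u x v + G.alternating u x w - t / 2)
  have ht₀ : 0 < t ^ 2 := by positivity
  have h₄ : (G.dist u v : ℝ) * t ^ 2 ≤ G.diam * t ^ 2 := by gcongr
  have h₅ : G.diam * t ^ 2 = x u ^ 2 / G.diam := by rw [ht]; field_simp
  have h₆ : t * x u = x u ^ 2 / G.diam := by rw [ht]; ring
  nlinarith

end Energy

end SimpleGraph

lemma exists_mulVec_eq_specMin_smul {n : ℕ} [NeZero n] (G : SimpleGraph (Fin n))
    [DecidableRel G.Adj] :
    ∃ x : Fin n → ℝ, (G.adjMatrix ℝ).mulVec x = specMin G • x ∧ ∑ v, x v ^ 2 = 1 := by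
  obtain ⟨i, hi⟩ := exists_eq_ciInf_of_finite (f := (adjMatrix_isHermitian G).eigenvalues)
  refine ⟨(adjMatrix_isHermitian G).eigenvectorBasis i, ?_, ?_⟩
  · rw [specMin, ← hi]
    exact (adjMatrix_isHermitian G).mulVec_eigenvectorBasis i
  · have h := (adjMatrix_isHermitian G).eigenvectorBasis.orthonormal.1 i
    rw [← EuclideanSpace.real_norm_sq_eq, h, one_pow]

lemma SimpleGraph.IsRegularOfDegree.le_specMax {n d : ℕ} [NeZero n] {G : SimpleGraph (Fin n)}
    [DecidableRel G.Adj] (hreg : G.IsRegularOfDegree d) : (d : ℝ) ≤ specMax G := by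
  have hspec : (d : ℝ) ∈ spectrum ℝ (G.adjMatrix ℝ) := by
    rw [← Matrix.spectrum_toLin', ← Module.End.hasEigenvalue_iff_mem_spectrum]
    refine Module.End.hasEigenvalue_of_hasEigenvector (x := Function.const _ 1)
      ⟨Module.End.mem_eigenspace_iff.mpr ?_, fun h ↦ one_ne_zero (congrFun h 0)⟩
    ext v
    simp [hreg.degree_eq]
  rw [(adjMatrix_isHermitian G).spectrum_real_eq_range_eigenvalues] at hspec
  obtain ⟨i, hi⟩ := hspec
  rw [← hi]
  exact le_ciSup (Set.finite_range _).bddAbove i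

/-- If `G` is a connected regular nonbipartite graph of order `n` and diameter `D`, then
`μ(G) + μ_min(G) > 1/(nD)`. -/
theorem specMax_add_specMin_gt_of_nonbipartite {n D d : ℕ}
    (G : SimpleGraph (Fin n)) [DecidableRel G.Adj]
    (hreg : G.IsRegularOfDegree d) (hconn : G.Connected) (hD : G.diam = D)
    (hnb : ¬ G.Colorable 2) :
    specMax G + specMin G > 1 / (n * D) := by
  have hn : NeZero n := ⟨by rintro rfl; exact hconn.nonempty.elim Fin.elim0⟩
  obtain ⟨x, hx, hnorm⟩ := exists_mulVec_eq_specMin_smul G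
  obtain ⟨u, -, hu⟩ := exists_max_image univ (fun v ↦ x v ^ 2) univ_nonempty
  have hn₀ : (0 : ℝ) < n := Nat.cast_pos.mpr (NeZero.pos n)
  have hlarge : 1 / (n : ℝ) ≤ x u ^ 2 := by
    have h := sum_le_card_nsmul univ (fun v ↦ x v ^ 2) _ hu
    rw [hnorm, card_univ, Fintype.card_fin, nsmul_eq_mul] at h
    rwa [div_le_iff₀' hn₀]
  have hu₀ : x u ≠ 0 := fun h ↦ by
    rw [h] at hlarge
    have : 0 < 1 / (n : ℝ) := by positivity
    linarith
  have hlt := hconn.sq_div_diam_lt_of_mulVec_eq_smul hreg hnb hx hu₀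
  rw [hnorm, mul_one, hD] at hlt
  calc 1 / ((n : ℝ) * D) = 1 / (n : ℝ) / D := by rw [div_div]
    _ ≤ x u ^ 2 / D := by gcongr
    _ < d + specMin G := hlt
    _ ≤ specMax G + specMin G := by gcongr; exact hreg.le_specMax
end

section
/- Let G be a connected graph of order n and diameter D, and let uv be an edge of G such that the graph H = G − uv (G with the edge uv deleted) is connected. Then for every vertex w of G, dist_H(w,u) + dist_H(w,v) ≤ 2D. -/
open SimpleGraph

/-- A walk of `G` between `w` and `x` is at least as long as a shortest walk avoiding the edge `uv`
or a shortest walk crossing it exactly once, in one of the two directions. -/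
theorem min_dist_deleteEdges_le_length {V : Type*} {G : SimpleGraph V} {u v : V}
    (hH : (G.deleteEdges {s(u, v)}).Connected) {w x : V} (p : G.Walk w x) :
    min ((G.deleteEdges {s(u, v)}).dist w x)
      (min ((G.deleteEdges {s(u, v)}).dist w u + 1 + (G.deleteEdges {s(u, v)}).dist v x)
        ((G.deleteEdges {s(u, v)}).dist w v + 1 + (G.deleteEdges {s(u, v)}).dist u x))
      ≤ p.length := by
  set H := G.deleteEdges {s(u, v)} with hHdef
  induction p with
  | nil => simp
  | @cons w y x h p ih =>
    rw [Walk.length_cons]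
    by_cases he : s(w, y) = s(u, v)
    · rcases Sym2.eq_iff.mp he with ⟨rfl, rfl⟩ | ⟨rfl, rfl⟩ <;>
        simp only [dist_self] at ih ⊢ <;> omega
    · have hadj : H.Adj w y := by simp [hHdef, deleteEdges_adj, h, he]
      have hwy : H.dist w y = 1 := dist_eq_one_iff_adj.mpr hadj
      have hx : H.dist w x ≤ H.dist w y + H.dist y x := hH.dist_triangle
      have hu : H.dist w u ≤ H.dist w y + H.dist y u := hH.dist_triangle
      have hv : H.dist w v ≤ H.dist w y + H.dist y v := hH.dist_triangle
      omega

/-- Every intermediate distance is attained on a shortest walk. -/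
theorem SimpleGraph.Connected.exists_dist_eq_of_le_dist {V : Type*} {H : SimpleGraph V}
    (hH : H.Connected) {w v : V} {i : ℕ} (hi : i ≤ H.dist w v) :
    ∃ x, H.dist w x = i ∧ H.dist x v = H.dist w v - i := by
  obtain ⟨p, hp⟩ := hH.exists_walk_length_eq_dist w v
  refine ⟨p.getVert i, ?_⟩
  have htake := dist_le (p.take i)
  have hdrop := dist_le (p.drop i)
  rw [Walk.take_length] at htake
  rw [Walk.drop_length] at hdrop
  have htri : H.dist w v ≤ H.dist w (p.getVert i) + H.dist (p.getVert i) v := hH.dist_triangle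
  omega

theorem dist_add_dist_le_two_mul_diam_of_dist_le {V : Type*} [Finite V] {G : SimpleGraph V}
    {u v w : V} (hconn : G.Connected) (hH : (G.deleteEdges {s(u, v)}).Connected)
    (hle : (G.deleteEdges {s(u, v)}).dist w u ≤ (G.deleteEdges {s(u, v)}).dist w v) :
    (G.deleteEdges {s(u, v)}).dist w u + (G.deleteEdges {s(u, v)}).dist w v ≤ 2 * G.diam := by
  have : Nonempty V := ⟨w⟩
  obtain ⟨x, hwx, hxv⟩ := hH.exists_dist_eq_of_le_dist (w := w) (v := v)
    (i := ((G.deleteEdges {s(u, v)}).dist w u + (G.deleteEdges {s(u, v)}).dist w v + 1) / 2)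
    (by omega)
  obtain ⟨p, hp⟩ := hconn.exists_walk_length_eq_dist w x
  have hmin := min_dist_deleteEdges_le_length hH p
  have hdiam : G.dist w x ≤ G.diam := dist_le_diam (connected_iff_ediam_ne_top.mp hconn)
  rw [dist_comm (u := v)] at hmin
  omega

/-- Let `G` be a connected graph of order `n` and diameter `D`, and let `uv` be an edge of `G`
such that the graph `H = G − uv` is connected. Then for every vertex `w` of `G`,
`dist_H(w,u) + dist_H(w,v) ≤ 2D`. -/
theorem dist_add_dist_le_two_mul_diam {n D : ℕ} (G : SimpleGraph (Fin n))
    (hconn : G.Connected) (hD : G.diam = D) (u v : Fin n) (huv : G.Adj u v)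
    (hH : (G.deleteEdges {s(u, v)}).Connected) (w : Fin n) :
    (G.deleteEdges {s(u, v)}).dist w u + (G.deleteEdges {s(u, v)}).dist w v ≤ 2 * D := by
  subst hD
  rcases le_total ((G.deleteEdges {s(u, v)}).dist w u) ((G.deleteEdges {s(u, v)}).dist w v)
    with hle | hle
  · exact dist_add_dist_le_two_mul_diam_of_dist_le hconn hH hle
  · rw [add_comm]
    rw [Sym2.eq_swap] at hH hle ⊢
    exact dist_add_dist_le_two_mul_diam_of_dist_le hconn hH hle
end

section
/- Let G be a d-regular graph of order n with (finite) diameter D, let uv be an edge of G, and let H = G − uv be the graph obtained from G by deleting the edge uv. Then d − μ(H) > 1/(nD). -/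
open SimpleGraph Finset

namespace SimpleGraph

variable {V : Type*}

/-- The vertices of a geodesic, as a sequence indexed by the distance to its starting point. -/
lemma Connected.exists_geodesic {G : SimpleGraph V} (hG : G.Connected) (w z : V) :
    ∃ p : ℕ → V, p 0 = w ∧ p (G.dist w z) = z ∧ (∀ k ≤ G.dist w z, G.dist w (p k) = k) ∧
      ∀ k < G.dist w z, G.Adj (p k) (p (k + 1)) := by
  obtain ⟨p, hp⟩ := hG.exists_walk_length_eq_dist w z
  refine ⟨p.getVert, by simp, by rw [← hp]; simp, fun k hk ↦ ?_, fun k hk ↦ ?_⟩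
  · have h1 : G.dist w (p.getVert k) ≤ k := by
      refine (dist_le (p.take k)).trans ?_
      simp [Walk.take_length]
    have h2 : G.dist (p.getVert k) z ≤ p.length - k := by
      refine (dist_le (p.drop k)).trans ?_
      simp [Walk.drop_length]
    have h3 := hG.dist_triangle (u := w) (v := p.getVert k) (w := z)
    omega
  · exact p.adj_getVert_succ (by omega)

variable [Fintype V]

/-- The contribution to the Laplacian quadratic form of `x` of the edges going from level `k` to
level `k + 1` of the function `l`. -/
def levelEnergy (H : SimpleGraph V) [DecidableRel H.Adj] (l : V → ℕ) (x : V → ℝ) (k : ℕ) : ℝ :=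
  ∑ i, ∑ j, if H.Adj i j ∧ l i = k ∧ l j = k + 1 then (x i - x j) ^ 2 else 0

section levelEnergy

variable (H : SimpleGraph V) [DecidableRel H.Adj] (l : V → ℕ) (x : V → ℝ)

lemma sum_levelEnergy_le (N : ℕ) :
    ∑ k ∈ range N, H.levelEnergy l x k ≤
      (∑ i, ∑ j, if H.Adj i j then (x i - x j) ^ 2 else 0) / 2 := by
  let a : V → V → ℝ := fun i j ↦ if H.Adj i j ∧ l j = l i + 1 then (x i - x j) ^ 2 else 0
  have h1 : ∑ k ∈ range N, H.levelEnergy l x k ≤ ∑ i, ∑ j, a i j := by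
    unfold levelEnergy
    rw [sum_comm]
    refine sum_le_sum fun i _ ↦ ?_
    rw [sum_comm]
    refine sum_le_sum fun j _ ↦ ?_
    have : ∀ k, (if H.Adj i j ∧ l i = k ∧ l j = k + 1 then (x i - x j) ^ 2 else 0) =
        if l i = k then a i j else 0 := by
      intro k
      simp only [a]
      grind
    simp only [this, sum_ite_eq]
    have : 0 ≤ a i j := by simp only [a]; split_ifs <;> positivity
    split_ifs <;> simp [this]
  have h2 : ∑ i, ∑ j, a i j + ∑ i, ∑ j, a j i ≤
      ∑ i, ∑ j, if H.Adj i j then (x i - x j) ^ 2 else 0 := by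
    simp only [← sum_add_distrib]
    refine sum_le_sum fun i _ ↦ sum_le_sum fun j _ ↦ ?_
    have h3 : (x i - x j) ^ 2 = (x j - x i) ^ 2 := by ring
    have h4 := sq_nonneg (x i - x j)
    simp only [a, H.adj_comm j i]
    split_ifs <;> first | (exfalso; omega) | (exfalso; tauto) | linarith
  rw [sum_comm (f := fun i j ↦ a j i)] at h2
  linarith

lemma levelEnergy_eq_sum_prod (k : ℕ) :
    H.levelEnergy l x k = ∑ e : V × V,
      if H.Adj e.1 e.2 ∧ l e.1 = k ∧ l e.2 = k + 1 then (x e.1 - x e.2) ^ 2 else 0 := by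
  rw [Fintype.sum_prod_type, levelEnergy]

variable {H l}

lemma sq_sub_le_levelEnergy {i j : V} {k : ℕ} (h : H.Adj i j) (hi : l i = k) (hj : l j = k + 1) :
    (x i - x j) ^ 2 ≤ H.levelEnergy l x k := by
  rw [levelEnergy_eq_sum_prod]
  refine le_trans ?_ (single_le_sum (fun e _ ↦ ?_) (mem_univ (i, j)))
  · simp [h, hi, hj]
  · split_ifs <;> positivity

lemma sq_sub_add_sq_sub_le_levelEnergy {i j i' j' : V} {k : ℕ} (h : H.Adj i j) (hi : l i = k)
    (hj : l j = k + 1) (h' : H.Adj i' j') (hi' : l i' = k) (hj' : l j' = k + 1) (hne : j ≠ j') :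
    (x i - x j) ^ 2 + (x i' - x j') ^ 2 ≤ H.levelEnergy l x k := by
  classical
  rw [levelEnergy_eq_sum_prod]
  refine le_trans ?_ (sum_le_sum_of_subset_of_nonneg (subset_univ {(i, j), (i', j')})
    fun e _ _ ↦ ?_)
  · rw [sum_pair (by simp [hne])]
    simp [h, hi, hj, h', hi', hj']
  · split_ifs <;> positivity

end levelEnergy

/-- The Laplacian quadratic form at an eigenvector of the adjacency matrix. -/
lemma sum_sq_sub_eq_of_adjMatrix_mulVec [DecidableEq V] (H : SimpleGraph V) [DecidableRel H.Adj]
    {x : V → ℝ} {t : ℝ} (hx : (H.adjMatrix ℝ).mulVec x = t • x) :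
    (∑ i, ∑ j, if H.Adj i j then (x i - x j) ^ 2 else 0) / 2 =
      ∑ i, (H.degree i - t) * x i ^ 2 := by
  rw [← lapMatrix_toLinearMap₂' ℝ H x, Matrix.toLinearMap₂'_apply', lapMatrix, Matrix.sub_mulVec,
    hx, dotProduct_sub, dotProduct_mulVec_degMatrix, dotProduct_smul, dotProduct, smul_eq_mul,
    mul_sum, ← sum_sub_distrib]
  exact sum_congr rfl fun i _ ↦ by ring

lemma degree_deleteEdges_pair [DecidableEq V] (G : SimpleGraph V) [DecidableRel G.Adj] {u v : V}
    [DecidableRel (G.deleteEdges {s(u, v)}).Adj] (huv : G.Adj u v) (i : V) :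
    ((G.deleteEdges {s(u, v)}).degree i : ℝ) =
      G.degree i - (if i = u then 1 else 0) - (if i = v then 1 else 0) := by
  have hG : (G.degree i : ℝ) = ∑ j, if G.Adj i j then 1 else 0 := by
    simp [← card_neighborFinset_eq_degree, neighborFinset_eq_filter]
  have hH : ((G.deleteEdges {s(u, v)}).degree i : ℝ) =
      ∑ j, if (G.deleteEdges {s(u, v)}).Adj i j then 1 else 0 := by
    simp [← card_neighborFinset_eq_degree, neighborFinset_eq_filter]
  have hu : (if i = u then 1 else 0 : ℝ) = ∑ j, if j = v then if i = u then 1 else 0 else 0 := by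
    simp
  have hv : (if i = v then 1 else 0 : ℝ) = ∑ j, if j = u then if i = v then 1 else 0 else 0 := by
    simp
  rw [hG, hH, hu, hv, ← sum_sub_distrib, ← sum_sub_distrib]
  refine sum_congr rfl fun j _ ↦ ?_
  have hne := huv.ne
  have huv' := huv.symm
  simp only [deleteEdges_adj, Set.mem_singleton_iff, Sym2.eq_iff]
  grind

end SimpleGraph

lemma sq_le_mul_sum_sq_sub_add_sq (y : ℕ → ℝ) (m : ℕ) :
    y 0 ^ 2 ≤ (m + 1) * (∑ k ∈ range m, (y k - y (k + 1)) ^ 2 + y m ^ 2) := by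
  let z : ℕ → ℝ := fun k ↦ if k < m then y k - y (k + 1) else y m
  have hz : ∀ k ∈ range m, z k = y k - y (k + 1) := fun k hk ↦ if_pos (mem_range.mp hk)
  have hm : z m = y m := if_neg (lt_irrefl m)
  have h := sq_sum_le_card_mul_sum_sq (s := range (m + 1)) (f := z)
  rw [sum_range_succ, sum_range_succ, sum_congr rfl hz, sum_range_sub', hm,
    sum_congr rfl fun k hk ↦ congrArg (· ^ 2) (hz k hk)] at h
  simpa using h

namespace SimpleGraph

variable {V : Type*} [Fintype V]

lemma Connected.sq_le_diam_mul_of_dist_le {G : SimpleGraph V} (hconn : G.Connected) {u v : V}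
    [DecidableRel (G.deleteEdges {s(u, v)}).Adj] (huv : G.Adj u v) (x : V → ℝ) (w : V)
    (hle : G.dist w u ≤ G.dist w v) :
    x w ^ 2 ≤ G.diam * ((∑ i, ∑ j,
      if (G.deleteEdges {s(u, v)}).Adj i j then (x i - x j) ^ 2 else 0) / 2 +
        x u ^ 2 + x v ^ 2) := by
  rename_i inst
  revert inst
  generalize hH : G.deleteEdges {s(u, v)} = H
  intro inst
  have : Nonempty V := ⟨u⟩
  have hne := connected_iff_ediam_ne_top.mp hconn
  have hu : G.dist w u ≤ G.diam := dist_le_diam hne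
  have hv : G.dist w v ≤ G.diam := dist_le_diam hne
  have hpos : 1 ≤ G.diam := (dist_eq_one_iff_adj.mpr huv) ▸ dist_le_diam hne
  have hadj : ∀ i j, G.Adj i j → G.dist w i < G.dist w u → H.Adj i j := by
    intro i j hij hi
    rw [← hH, deleteEdges_adj, Set.mem_singleton_iff, Sym2.eq_iff]
    refine ⟨hij, ?_⟩
    rintro (⟨rfl, rfl⟩ | ⟨rfl, rfl⟩) <;> omega
  obtain ⟨p, hp0, hpu, hpd, hpa⟩ := hconn.exists_geodesic w u
  have hpH : ∀ k < G.dist w u, H.Adj (p k) (p (k + 1)) := fun k hk ↦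
    hadj _ _ (hpa k hk) (by rwa [hpd k hk.le])
  have hE := H.sum_levelEnergy_le (G.dist w) x (G.dist w u)
  set E := (∑ i, ∑ j, if H.Adj i j then (x i - x j) ^ 2 else 0) / 2
  by_cases hlt : G.dist w u < G.diam
  · have hC := sq_le_mul_sum_sq_sub_add_sq (fun k ↦ x (p k)) (G.dist w u)
    simp only [hp0, hpu] at hC
    have hS : ∑ k ∈ range (G.dist w u), (x (p k) - x (p (k + 1))) ^ 2 ≤ E :=
      (sum_le_sum fun k hk ↦ sq_sub_le_levelEnergy x (hpH k (mem_range.mp hk))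
        (hpd k (mem_range.mp hk).le) (hpd _ (mem_range.mp hk))).trans hE
    refine hC.trans (mul_le_mul (mod_cast hlt) ?_ (by positivity) (by positivity))
    nlinarith [sq_nonneg (x v)]
  · obtain ⟨q, hq0, hqv, hqd, hqa⟩ := hconn.exists_geodesic w v
    have huv' : G.dist w v = G.dist w u := by omega
    rw [huv'] at hqv hqd hqa
    have hqH : ∀ k < G.dist w u, H.Adj (q k) (q (k + 1)) := fun k hk ↦
      hadj _ _ (hqa k hk) (by rwa [hqd k hk.le])
    obtain ⟨m, hm⟩ : ∃ m, G.dist w u = m + 1 := ⟨G.dist w u - 1, by omega⟩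
    have hdiam : G.diam = m + 1 := by omega
    rw [hm] at hpu hpd hqv hqd hpH hqH hE
    rw [hdiam]
    have hC := sq_le_mul_sum_sq_sub_add_sq (fun k ↦ (x (p k) + x (q k)) / 2) m
    simp only [hp0, hq0, add_self_div_two] at hC
    rw [sum_range_succ] at hE
    have hS : ∑ k ∈ range m, ((x (p k) + x (q k)) / 2 - (x (p (k + 1)) + x (q (k + 1))) / 2) ^ 2 ≤
        ∑ k ∈ range m, H.levelEnergy (G.dist w) x k := by
      refine sum_le_sum fun k hk ↦ ?_
      have hk := mem_range.mp hk
      have h1 := sq_sub_le_levelEnergy x (hpH k (by omega)) (hpd k (by omega))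
        (hpd _ (by omega))
      have h2 := sq_sub_le_levelEnergy x (hqH k (by omega)) (hqd k (by omega))
        (hqd _ (by omega))
      nlinarith [sq_nonneg ((x (p k) - x (p (k + 1))) - (x (q k) - x (q (k + 1))))]
    have hL := sq_sub_add_sq_sub_le_levelEnergy x (hpH m (by omega)) (hpd m (by omega))
      (hpd _ (by omega)) (hqH m (by omega)) (hqd m (by omega)) (hqd _ (by omega))
      (by rw [hpu, hqv]; exact huv.ne)
    rw [hpu, hqv] at hL
    have hM : ((x (p m) + x (q m)) / 2) ^ 2 ≤
        (x (p m) - x u) ^ 2 + (x (q m) - x v) ^ 2 + x u ^ 2 + x v ^ 2 := by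
      nlinarith [sq_nonneg ((x (p m) - x u) - (x (q m) - x v)), sq_nonneg (x u - x v),
        sq_nonneg ((x (p m) - x u) + (x (q m) - x v) - (x u + x v))]
    push_cast
    refine hC.trans (mul_le_mul_of_nonneg_left ?_ (by positivity))
    linarith

lemma Connected.sq_le_diam_mul {G : SimpleGraph V} (hconn : G.Connected) {u v : V}
    [DecidableRel (G.deleteEdges {s(u, v)}).Adj] (huv : G.Adj u v) (x : V → ℝ) (w : V) :
    x w ^ 2 ≤ G.diam * ((∑ i, ∑ j,
      if (G.deleteEdges {s(u, v)}).Adj i j then (x i - x j) ^ 2 else 0) / 2 +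
        x u ^ 2 + x v ^ 2) := by
  rcases le_total (G.dist w u) (G.dist w v) with h | h
  · exact hconn.sq_le_diam_mul_of_dist_le huv x w h
  · have hswap : s(u, v) = s(v, u) := Sym2.eq_swap
    simp only [hswap, add_right_comm _ (x u ^ 2)]
    have : DecidableRel (G.deleteEdges {s(v, u)}).Adj := Classical.decRel _
    convert hconn.sq_le_diam_mul_of_dist_le huv.symm x w h

end SimpleGraph

lemma exists_adjMatrix_mulVec_eq_specMax_smul {n : ℕ} [NeZero n] (H : SimpleGraph (Fin n))
    [DecidableRel H.Adj] :
    ∃ x : Fin n → ℝ, ∑ i, x i ^ 2 = 1 ∧ (H.adjMatrix ℝ).mulVec x = specMax H • x := by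
  have hA := adjMatrix_isHermitian H
  obtain ⟨j, hj⟩ := exists_eq_ciSup_of_finite (f := hA.eigenvalues)
  refine ⟨hA.eigenvectorBasis j, ?_, ?_⟩
  · rw [← EuclideanSpace.real_norm_sq_eq, hA.eigenvectorBasis.norm_eq_one, one_pow]
  · rw [hA.mulVec_eigenvectorBasis, hj, specMax]

/-- Let `G` be a `d`-regular graph of order `n` with (finite) diameter `D`, let `uv` be an edge
of `G`, and let `H = G − uv`. Then `d − μ(H) > 1/(nD)`. -/
theorem degree_sub_specMax_deleteEdge_gt {n d D : ℕ}
    (G : SimpleGraph (Fin n)) [DecidableRel G.Adj] (u v : Fin n)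
    [DecidableRel (G.deleteEdges {s(u, v)}).Adj]
    (hreg : G.IsRegularOfDegree d) (hconn : G.Connected) (hD : G.diam = D)
    (huv : G.Adj u v) :
    (d : ℝ) - specMax (G.deleteEdges {s(u, v)}) > 1 / (n * D) := by
  have : NeZero n := ⟨fun h ↦ (h ▸ u).elim0⟩
  have hn : (0 : ℝ) < n := by exact_mod_cast NeZero.pos n
  have hD1 : (1 : ℝ) ≤ D := by
    have h := dist_le_diam (connected_iff_ediam_ne_top.mp hconn) (u := u) (v := v)
    rw [dist_eq_one_iff_adj.mpr huv, hD] at h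
    exact_mod_cast h
  obtain ⟨x, hx1, hx⟩ := exists_adjMatrix_mulVec_eq_specMax_smul (G.deleteEdges {s(u, v)})
  have hE := sum_sq_sub_eq_of_adjMatrix_mulVec _ hx
  have hw := hconn.sq_le_diam_mul huv x
  have hgap : (∑ i, ∑ j, if (G.deleteEdges {s(u, v)}).Adj i j then (x i - x j) ^ 2 else 0) / 2 +
      x u ^ 2 + x v ^ 2 = d - specMax (G.deleteEdges {s(u, v)}) := by
    simp only [degree_deleteEdges_pair G huv, hreg.degree_eq, sub_mul, sum_sub_distrib, ← mul_sum,
      hx1, ite_mul, one_mul, zero_mul, sum_ite_eq', mem_univ, if_true] at hE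
    rw [hE]
    simp
    ring
  have hnn : 0 ≤ (∑ i, ∑ j,
      if (G.deleteEdges {s(u, v)}).Adj i j then (x i - x j) ^ 2 else 0) / 2 := by positivity
  rw [hgap, hD] at hw
  rw [gt_iff_lt, div_lt_iff₀ (by positivity)]
  by_cases hbig : ∃ w, 1 < n * x w ^ 2
  · obtain ⟨w, hbig⟩ := hbig
    calc (1 : ℝ) < n * x w ^ 2 := hbig
      _ ≤ n * (D * (d - specMax (G.deleteEdges {s(u, v)}))) := by gcongr; exact hw w
      _ = _ := by ring
  · push Not at hbig
    have hconst : ∀ w, n * x w ^ 2 = 1 := by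
      have hsum : ∑ w, n * x w ^ 2 = ∑ _w : Fin n, (1 : ℝ) := by simp [← mul_sum, hx1]
      exact fun w ↦ (sum_eq_sum_iff_of_le fun i _ ↦ hbig i).mp hsum w (mem_univ w)
    have h2 : 2 ≤ n * (d - specMax (G.deleteEdges {s(u, v)})) := by
      rw [← hgap]
      nlinarith [hconst u, hconst v, mul_nonneg hn.le hnn]
    nlinarith
end

section
/- For every graph G there exists a bipartite spanning subgraph H of G such that μ_min(H) ≤ μ_min(G); equivalently, μ(H) ≥ −μ_min(G). In particular, μ(G) + μ_min(G) ≥ μ(G) − μ(H) for this subgraph H. -/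
open SimpleGraph Finset

open Matrix in
/-- The quadratic form of a real symmetric matrix, expanded in an orthonormal eigenbasis. -/
lemma dotProduct_mulVec_eq_sum_eigenvalues {n : ℕ} {A : Matrix (Fin n) (Fin n) ℝ}
    (hA : A.IsHermitian) (x : Fin n → ℝ) :
    x ⬝ᵥ A *ᵥ x =
      ∑ i, hA.eigenvalues i * (x ⬝ᵥ (hA.eigenvectorBasis i).ofLp) ^ 2 := by
  have h := hA.eigenvectorBasis.sum_inner_mul_inner (WithLp.toLp 2 x) (WithLp.toLp 2 (A *ᵥ x))
  simp only [EuclideanSpace.inner_eq_star_dotProduct, star_trivial] at h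
  rw [dotProduct_comm, ← h]
  refine Finset.sum_congr rfl fun i _ => ?_
  have hT : Aᵀ = A := by rw [← conjTranspose_eq_transpose_of_trivial, hA.eq]
  rw [dotProduct_comm (A *ᵥ x), dotProduct_mulVec, ← mulVec_transpose, hT,
    hA.mulVec_eigenvectorBasis, smul_dotProduct, smul_eq_mul,
    dotProduct_comm x]
  ring

open Matrix in
/-- The Euclidean norm, expanded in the eigenbasis of a real symmetric matrix. -/
lemma dotProduct_self_eq_sum_eigenvectorBasis {n : ℕ} {A : Matrix (Fin n) (Fin n) ℝ}
    (hA : A.IsHermitian) (x : Fin n → ℝ) :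
    x ⬝ᵥ x = ∑ i, (x ⬝ᵥ (hA.eigenvectorBasis i).ofLp) ^ 2 := by
  have h := hA.eigenvectorBasis.sum_inner_mul_inner (WithLp.toLp 2 x) (WithLp.toLp 2 x)
  simp only [EuclideanSpace.inner_eq_star_dotProduct, star_trivial] at h
  rw [← h]
  refine Finset.sum_congr rfl fun i _ => ?_
  rw [dotProduct_comm x]
  ring

open Matrix in
lemma specMin_mul_le_dotProduct_mulVec {n : ℕ} (G : SimpleGraph (Fin n)) [DecidableRel G.Adj]
    (x : Fin n → ℝ) : specMin G * (x ⬝ᵥ x) ≤ x ⬝ᵥ G.adjMatrix ℝ *ᵥ x := by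
  rw [dotProduct_mulVec_eq_sum_eigenvalues (adjMatrix_isHermitian G),
    dotProduct_self_eq_sum_eigenvectorBasis (adjMatrix_isHermitian G), Finset.mul_sum]
  gcongr with i
  exact ciInf_le (Set.finite_range _).bddBelow i

open Matrix in
lemma dotProduct_mulVec_le_specMax_mul {n : ℕ} (G : SimpleGraph (Fin n)) [DecidableRel G.Adj]
    (x : Fin n → ℝ) : x ⬝ᵥ G.adjMatrix ℝ *ᵥ x ≤ specMax G * (x ⬝ᵥ x) := by
  rw [dotProduct_mulVec_eq_sum_eigenvalues (adjMatrix_isHermitian G),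
    dotProduct_self_eq_sum_eigenvectorBasis (adjMatrix_isHermitian G), Finset.mul_sum]
  gcongr with i
  exact le_ciSup (Set.finite_range _).bddAbove i

open Matrix in
/-- The smallest eigenvalue is attained by the quadratic form at some unit vector. -/
lemma exists_dotProduct_mulVec_eq_specMin {n : ℕ} [NeZero n] (G : SimpleGraph (Fin n))
    [DecidableRel G.Adj] :
    ∃ x : Fin n → ℝ, x ⬝ᵥ x = 1 ∧ x ⬝ᵥ G.adjMatrix ℝ *ᵥ x = specMin G := by
  have hA := adjMatrix_isHermitian G
  obtain ⟨i, hi⟩ := exists_eq_ciInf_of_finite (f := hA.eigenvalues)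
  have hx : (hA.eigenvectorBasis i).ofLp ⬝ᵥ (hA.eigenvectorBasis i).ofLp = 1 := by
    have h := hA.eigenvectorBasis.inner_eq_one i
    rwa [EuclideanSpace.inner_eq_star_dotProduct, star_trivial] at h
  refine ⟨_, hx, ?_⟩
  rw [hA.mulVec_eigenvectorBasis, dotProduct_smul, hx, smul_eq_mul, mul_one, hi, specMin]

/-- The spanning subgraph of `G` whose edges have exactly one endpoint in `U`. -/
def cutSubgraph {V : Type*} (G : SimpleGraph V) (U : Set V) : SimpleGraph V where
  Adj u v := G.Adj u v ∧ ¬(u ∈ U ↔ v ∈ U)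
  symm := ⟨fun _ _ h => ⟨h.1.symm, fun h' => h.2 h'.symm⟩⟩
  loopless := ⟨fun _ h => h.2 Iff.rfl⟩

lemma cutSubgraph_le {V : Type*} (G : SimpleGraph V) (U : Set V) : cutSubgraph G U ≤ G :=
  fun _ _ h => h.1

lemma cutSubgraph_colorable {V : Type*} (G : SimpleGraph V) (U : Set V) :
    (cutSubgraph G U).Colorable 2 := by
  classical
  have C : (cutSubgraph G U).Coloring Prop :=
    SimpleGraph.Coloring.mk (fun v => v ∈ U) fun h he => h.2 (iff_of_eq he)
  simpa using C.colorable

open Matrix in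
lemma dotProduct_adjMatrix_mulVec_eq_sum {n : ℕ} (G : SimpleGraph (Fin n)) [DecidableRel G.Adj]
    (x : Fin n → ℝ) :
    x ⬝ᵥ G.adjMatrix ℝ *ᵥ x = ∑ i, ∑ j, if G.Adj i j then x i * x j else 0 := by
  simp [dotProduct, mulVec, Finset.mul_sum, SimpleGraph.adjMatrix_apply]

open Matrix in
lemma dotProduct_cutSubgraph_mulVec_le {n : ℕ} (G : SimpleGraph (Fin n)) [DecidableRel G.Adj]
    (x : Fin n → ℝ) [DecidableRel (cutSubgraph G {u | x u < 0}).Adj] :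
    x ⬝ᵥ (cutSubgraph G {u | x u < 0}).adjMatrix ℝ *ᵥ x ≤ x ⬝ᵥ G.adjMatrix ℝ *ᵥ x := by
  simp only [dotProduct_adjMatrix_mulVec_eq_sum]
  gcongr with i _ j
  simp only [cutSubgraph, Set.mem_ofPred_eq]
  by_cases hG : G.Adj i j <;> by_cases hi : x i < 0 <;> by_cases hj : x j < 0 <;>
    simp only [hG, hi, hj] <;> norm_num <;> nlinarith

open Matrix in
lemma dotProduct_abs_cutSubgraph_mulVec {n : ℕ} (G : SimpleGraph (Fin n))
    (x : Fin n → ℝ) [DecidableRel (cutSubgraph G {u | x u < 0}).Adj] :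
    |x| ⬝ᵥ (cutSubgraph G {u | x u < 0}).adjMatrix ℝ *ᵥ |x| =
      -(x ⬝ᵥ (cutSubgraph G {u | x u < 0}).adjMatrix ℝ *ᵥ x) := by
  simp only [dotProduct_adjMatrix_mulVec_eq_sum, ← Finset.sum_neg_distrib]
  refine Finset.sum_congr rfl fun i _ => Finset.sum_congr rfl fun j _ => ?_
  split_ifs with h
  · have hx : x i * x j ≤ 0 := by
      have := h.2
      simp only [Set.mem_ofPred_eq] at this
      by_cases hi : x i < 0 <;> by_cases hj : x j < 0 <;> simp only [hi, hj] at this <;>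
        first | exact absurd trivial this | nlinarith
    rw [Pi.abs_apply, Pi.abs_apply, ← abs_mul, abs_of_nonpos hx]
  · simp

/-- For every graph `G` there exists a bipartite spanning subgraph `H` of `G` such that
`μ_min(H) ≤ μ_min(G)`; equivalently, `μ(H) ≥ −μ_min(G)`. In particular,
`μ(G) + μ_min(G) ≥ μ(G) − μ(H)` for this subgraph `H`. -/
theorem exists_bipartite_spanning_subgraph_specMin_le {n : ℕ}
    (G : SimpleGraph (Fin n)) [DecidableRel G.Adj] :
    ∃ (H : SimpleGraph (Fin n)) (_ : DecidableRel H.Adj), H ≤ G ∧ H.Colorable 2 ∧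
      specMin H ≤ specMin G ∧ specMax H ≥ -specMin G ∧
      specMax G + specMin G ≥ specMax G - specMax H := by
  classical
  suffices h : ∃ H : SimpleGraph (Fin n), H ≤ G ∧ H.Colorable 2 ∧
      specMin H ≤ specMin G ∧ -specMin G ≤ specMax H by
    obtain ⟨H, hle, hcol, hmin, hmax⟩ := h
    exact ⟨H, inferInstance, hle, hcol, hmin, hmax, by linarith⟩
  rcases Nat.eq_zero_or_pos n with rfl | hn
  · exact ⟨⊥, bot_le, ⟨SimpleGraph.Coloring.mk (fun _ => 0) (by simp)⟩, by simp [specMin],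
      by simp [specMin, specMax]⟩
  have : NeZero n := ⟨hn.ne'⟩
  obtain ⟨x, hx, hxG⟩ := exists_dotProduct_mulVec_eq_specMin G
  have hcut := dotProduct_cutSubgraph_mulVec_le G x
  refine ⟨cutSubgraph G {u | x u < 0}, cutSubgraph_le _ _, cutSubgraph_colorable _ _, ?_, ?_⟩
  · have hmin := specMin_mul_le_dotProduct_mulVec (cutSubgraph G {u | x u < 0}) x
    rw [hx] at hmin
    linarith
  · have hmax := dotProduct_mulVec_le_specMax_mul (cutSubgraph G {u | x u < 0}) |x|
    have habs : |x| ⬝ᵥ |x| = 1 := by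
      rw [← hx]
      simp [dotProduct]
    rw [dotProduct_abs_cutSubgraph_mulVec, habs] at hmax
    linarith
end
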